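/- The trilogarithm identity 2·Li_3(1/3) − Li_3(−1/3) = (13·ζ(3) − π²·log(3) + log³(3)) / 6 holds. -/

import Mathlib

/-- The classical polylogarithm `Li_k(z) = ∑_{n≥1} z^n/n^k`. -/
noncomputable def Li (k : ℕ) (z : ℝ) : ℝ :=
  ∑' n : ℕ, z ^ (n + 1) / ((n : ℝ) + 1) ^ k

open Real Set

lemma const_aux (f : ℝ → ℝ) (s : ℝ) (hs : 0 < s) (hc : ContinuousOn f (Icc 0 s))
    (hd : ∀ x ∈ Ioo 0 s, HasDerivAt f 0 x) : f s = f 0 := by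
  obtain ⟨c, _, h⟩ := exists_hasDerivAt_eq_slope f (fun _ => 0) hs hc hd
  have h2 : s - 0 ≠ 0 := by linarith
  field_simp at h
  linarith

lemma Li_zero (k : ℕ) : Li k 0 = 0 := by simp [Li]

lemma Li_cont (k : ℕ) (hk : 2 ≤ k) : ContinuousOn (Li k) (Icc (-1) 1) := by
  unfold Li
  refine continuousOn_tsum (u := fun n : ℕ => 1 / ((n : ℝ) + 1) ^ k) (fun n => by fun_prop) ?_ ?_
  · have := (summable_nat_add_iff 1).2 (Real.summable_one_div_nat_pow.2 (show 1 < k by omega))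
    simpa using this
  · intro n x hx
    rw [norm_div, norm_pow, norm_pow, Real.norm_eq_abs, Real.norm_eq_abs,
      abs_of_pos (show (0:ℝ) < n + 1 by positivity)]
    gcongr
    exact pow_le_one₀ (abs_nonneg _) (abs_le.2 hx)

lemma Li_comp_cont (k : ℕ) (hk : 2 ≤ k) (g : ℝ → ℝ) (s : Set ℝ) (hg : ContinuousOn g s)
    (h : ∀ x ∈ s, |g x| ≤ 1) : ContinuousOn (fun x => Li k (g x)) s :=
  (Li_cont k hk).comp hg (fun x hx => abs_le.1 (h x hx))

lemma Li_one (x : ℝ) (hx : |x| < 1) : Li 1 x = -log (1 - x) := by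
  unfold Li
  simpa using (Real.hasSum_pow_div_log_of_abs_lt_one hx).tsum_eq

lemma Li_deriv (k : ℕ) (x : ℝ) (hx : |x| < 1) (h0 : x ≠ 0) :
    HasDerivAt (Li (k + 1)) (Li k x / x) x := by
  obtain ⟨r, hr1, hr2⟩ := exists_between hx
  have hr0 : 0 ≤ r := (abs_nonneg x).trans hr1.le
  have key : HasDerivAt (fun z : ℝ => ∑' n : ℕ, z ^ (n + 1) / ((n : ℝ) + 1) ^ (k + 1))
      (∑' n : ℕ, x ^ n / ((n : ℝ) + 1) ^ k) x := by
    refine hasDerivAt_tsum_of_isPreconnected (u := fun n : ℕ => r ^ n) (t := Ioo (-r) r)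
      (g' := fun n z => z ^ n / ((n : ℝ) + 1) ^ k) (y₀ := 0)
      (summable_geometric_of_lt_one hr0 hr2) isOpen_Ioo
      isPreconnected_Ioo ?_ ?_ ?_ ?_ (abs_lt.1 hr1)
    · intro n y hy
      have := (hasDerivAt_pow (n + 1) y).div_const (((n : ℝ) + 1) ^ (k + 1))
      refine HasDerivAt.congr_deriv (this) ?_
      have : (n : ℝ) + 1 ≠ 0 := by positivity
      push_cast
      field_simp
      ring
    · intro n y hy
      rw [norm_div, norm_pow, norm_pow, Real.norm_eq_abs, Real.norm_eq_abs,
        abs_of_pos (show (0:ℝ) < n + 1 by positivity)]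
      have h1 : |y| ^ n ≤ r ^ n := by
        gcongr; exact (abs_lt.2 hy).le
      have h2 : (1:ℝ) ≤ ((n : ℝ) + 1) ^ k := one_le_pow₀ (by linarith [n.cast_nonneg (α := ℝ)])
      exact (div_le_self (by positivity) h2).trans h1
    · exact ⟨by linarith [lt_of_le_of_lt (abs_nonneg x) hr1], lt_of_le_of_lt (abs_nonneg x) hr1⟩
    · simpa using summable_zero
  have e : Li k x / x = ∑' n : ℕ, x ^ n / ((n : ℝ) + 1) ^ k := by
    unfold Li
    rw [← tsum_div_const]
    congr 1; ext n
    rw [pow_succ]; field_simp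
  rw [e]; exact key

lemma Li3_comp (g : ℝ → ℝ) (g' x : ℝ) (hg : HasDerivAt g g' x) (h1 : |g x| < 1) (h0 : g x ≠ 0) :
    HasDerivAt (fun x => Li 3 (g x)) (Li 2 (g x) / g x * g') x :=
  (Li_deriv 2 (g x) h1 h0).comp x hg

lemma Li2_comp (g : ℝ → ℝ) (g' x : ℝ) (hg : HasDerivAt g g' x) (h1 : |g x| < 1) (h0 : g x ≠ 0) :
    HasDerivAt (fun x => Li 2 (g x)) (-log (1 - g x) / g x * g') x := by
  have := (Li_deriv 1 (g x) h1 h0).comp x hg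
  rwa [Li_one _ h1] at this

lemma sq2 (s : ℝ) (h0 : 0 < s) (h1 : s ≤ 1) : Li 2 (s ^ 2) = 2 * Li 2 s + 2 * Li 2 (-s) := by
  have := const_aux (fun t => Li 2 (t ^ 2) - 2 * Li 2 t - 2 * Li 2 (-t)) s h0 ?_ ?_
  · simp [Li_zero] at this; linarith
  · refine ((Li_comp_cont 2 le_rfl _ _ (by fun_prop) ?_).sub (continuousOn_const.mul
      (Li_comp_cont 2 le_rfl (fun t => t) _ (by fun_prop) ?_))).sub (continuousOn_const.mul
      (Li_comp_cont 2 le_rfl _ _ (by fun_prop) ?_)) <;> rintro x ⟨hx, hx'⟩ <;> rw [abs_le] <;>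
      constructor <;> nlinarith
  · rintro x ⟨hx, hx'⟩
    have A := Li2_comp (fun t => t ^ 2) _ x (hasDerivAt_pow 2 x)
      (by rw [abs_lt]; constructor <;> nlinarith) (by positivity)
    have B := Li2_comp (fun t => t) _ x (hasDerivAt_id x)
      (by rw [abs_lt]; constructor <;> nlinarith) hx.ne'
    have C := Li2_comp (fun t => -t) _ x (hasDerivAt_neg x)
      (by rw [abs_lt]; constructor <;> nlinarith) (by linarith)
    refine HasDerivAt.congr_deriv ((A.sub (B.const_mul 2)).sub (C.const_mul 2)) ?_
    have : log (1 - x ^ 2) = log (1 - x) + log (1 + x) := by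
      rw [← log_mul (by linarith) (by linarith)]; ring_nf
    simp only [this, sub_neg_eq_add]
    field_simp; push_cast; ring

lemma sq3 : Li 3 1 = 4 * Li 3 1 + 4 * Li 3 (-1) := by
  have := const_aux (fun t => Li 3 (t ^ 2) - 4 * Li 3 t - 4 * Li 3 (-t)) 1 one_pos ?_ ?_
  · simp [Li_zero] at this; linarith
  · refine ((Li_comp_cont 3 (by norm_num) _ _ (by fun_prop) ?_).sub (continuousOn_const.mul
      (Li_comp_cont 3 (by norm_num) (fun t => t) _ (by fun_prop) ?_))).sub (continuousOn_const.mul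
      (Li_comp_cont 3 (by norm_num) _ _ (by fun_prop) ?_)) <;> rintro x ⟨hx, hx'⟩ <;>
      rw [abs_le] <;> constructor <;> nlinarith
  · rintro x ⟨hx, hx'⟩
    have A := Li3_comp (fun t => t ^ 2) _ x (hasDerivAt_pow 2 x)
      (by rw [abs_lt]; constructor <;> nlinarith) (by positivity)
    have B := Li3_comp (fun t => t) _ x (hasDerivAt_id x)
      (by rw [abs_lt]; constructor <;> nlinarith) hx.ne'
    have C := Li3_comp (fun t => -t) _ x (hasDerivAt_neg x)
      (by rw [abs_lt]; constructor <;> nlinarith) (by linarith)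
    refine HasDerivAt.congr_deriv ((A.sub (B.const_mul 4)).sub (C.const_mul 4)) ?_
    simp only [sq2 x hx hx'.le]
    field_simp; push_cast; ring

lemma Li2_one : Li 2 1 = π ^ 2 / 6 := by
  rw [← hasSum_zeta_two.tsum_eq, hasSum_zeta_two.summable.tsum_eq_zero_add]
  simp [Li]

lemma dlogm (x : ℝ) (hx : x < 1) : HasDerivAt (fun t => log (1 - t)) (-1 / (1 - x)) x :=
  ((hasDerivAt_id x).const_sub 1).log (by simp; linarith)

lemma dlogp (x : ℝ) (hx : -1 < x) : HasDerivAt (fun t => log (1 + t)) (1 / (1 + x)) x :=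
  ((hasDerivAt_id x).const_add 1).log (by simp; linarith)

lemma dA (x : ℝ) (hx : x < 1) : HasDerivAt (fun t : ℝ => -(t / (1 - t))) (-1 / (1 - x) ^ 2) x := by
  have h : 1 - x ≠ 0 := by linarith
  refine HasDerivAt.congr_deriv (((hasDerivAt_id x).div ((hasDerivAt_id x).const_sub 1) h).neg) ?_
  simp; field_simp

lemma dB (x : ℝ) (hx : -1 < x) : HasDerivAt (fun t : ℝ => t / (1 + t)) (1 / (1 + x) ^ 2) x := by
  have h : 1 + x ≠ 0 := by linarith
  refine HasDerivAt.congr_deriv (((hasDerivAt_id x).div ((hasDerivAt_id x).const_add 1) h)) ?_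
  simp

lemma dU (x : ℝ) (hx : -1 < x) :
    HasDerivAt (fun t : ℝ => (1 - t) / (1 + t)) (-2 / (1 + x) ^ 2) x := by
  have h : 1 + x ≠ 0 := by linarith
  refine HasDerivAt.congr_deriv ((((hasDerivAt_id x).const_sub 1).div ((hasDerivAt_id x).const_add 1) h)) ?_
  simp; ring

lemma bA (x : ℝ) (h0 : 0 ≤ x) (h1 : x ≤ 1 / 2) : |-(x / (1 - x))| ≤ 1 := by
  have : 0 < 1 - x := by linarith
  rw [abs_neg, abs_of_nonneg (by positivity), div_le_one this]; linarith

lemma bA' (x : ℝ) (h0 : 0 ≤ x) (h1 : x < 1 / 2) : |-(x / (1 - x))| < 1 := by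
  have : 0 < 1 - x := by linarith
  rw [abs_neg, abs_of_nonneg (by positivity), div_lt_one this]; linarith

lemma bB (x : ℝ) (h0 : 0 ≤ x) : |x / (1 + x)| < 1 := by
  rw [abs_of_nonneg (by positivity), div_lt_one (by positivity)]; linarith

lemma bU (x : ℝ) (h0 : 0 ≤ x) (h1 : x ≤ 1) : |(1 - x) / (1 + x)| ≤ 1 := by
  rw [abs_of_nonneg (div_nonneg (by linarith) (by linarith)), div_le_one (by positivity)]; linarith

lemma bU' (x : ℝ) (h0 : 0 < x) (h1 : x ≤ 1) : |(1 - x) / (1 + x)| < 1 := by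
  rw [abs_of_nonneg (div_nonneg (by linarith) (by linarith)), div_lt_one (by positivity)]; linarith

lemma landenA (s : ℝ) (h0 : 0 < s) (h1 : s ≤ 1 / 2) :
    Li 2 (-(s / (1 - s))) = - Li 2 s - log (1 - s) ^ 2 / 2 := by
  have := const_aux (fun t => Li 2 (-(t / (1 - t))) + Li 2 t + log (1 - t) ^ 2 / 2) s h0 ?_ ?_
  · simp [Li_zero] at this; linarith
  · refine ((Li_comp_cont 2 le_rfl _ _ ?_ ?_).add
      (Li_comp_cont 2 le_rfl (fun t => t) _ (by fun_prop) ?_)).add (ContinuousOn.div_const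
      (ContinuousOn.pow ?_ 2) _)
    · rintro x ⟨hx, hx'⟩
      exact (dA x (by linarith)).continuousAt.continuousWithinAt
    · rintro x ⟨hx, hx'⟩
      exact bA x hx (by linarith)
    · rintro x ⟨hx, hx'⟩
      rw [abs_le]; constructor <;> linarith
    · rintro x ⟨hx, hx'⟩
      exact (dlogm x (by linarith)).continuousAt.continuousWithinAt
  · rintro x ⟨hx, hx'⟩
    have hp : 0 < 1 - x := by linarith
    have A := Li2_comp _ _ x (dA x (by linarith)) (bA' x hx.le (by linarith))
      (by simp; constructor <;> linarith)
    have B := Li2_comp (fun t => t) _ x (hasDerivAt_id x)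
      (by rw [abs_lt]; constructor <;> linarith) hx.ne'
    refine HasDerivAt.congr_deriv ((A.add B).add (((dlogm x (by linarith)).pow 2).div_const 2)) ?_
    have : log (1 - -(x / (1 - x))) = -log (1 - x) := by
      rw [← log_inv]; congr 1; field_simp; ring
    simp only [this]
    field_simp; push_cast; ring

lemma landenB (s : ℝ) (h0 : 0 < s) (h1 : s ≤ 1) :
    Li 2 (s / (1 + s)) = - Li 2 (-s) - log (1 + s) ^ 2 / 2 := by
  have := const_aux (fun t => Li 2 (t / (1 + t)) + Li 2 (-t) + log (1 + t) ^ 2 / 2) s h0 ?_ ?_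
  · simp [Li_zero] at this; linarith
  · refine ((Li_comp_cont 2 le_rfl _ _ ?_ ?_).add
      (Li_comp_cont 2 le_rfl _ _ (by fun_prop) ?_)).add (ContinuousOn.div_const
      (ContinuousOn.pow ?_ 2) _)
    · rintro x ⟨hx, hx'⟩
      exact (dB x (by linarith)).continuousAt.continuousWithinAt
    · rintro x ⟨hx, hx'⟩
      exact (bB x hx).le
    · rintro x ⟨hx, hx'⟩
      rw [abs_le]; constructor <;> linarith
    · rintro x ⟨hx, hx'⟩
      exact (dlogp x (by linarith)).continuousAt.continuousWithinAt
  · rintro x ⟨hx, hx'⟩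
    have hp : 0 < 1 + x := by linarith
    have A := Li2_comp _ _ x (dB x (by linarith)) (bB x hx.le) (by positivity)
    have B := Li2_comp (fun t => -t) _ x (hasDerivAt_neg x)
      (by rw [abs_lt]; constructor <;> linarith) (by linarith)
    refine HasDerivAt.congr_deriv ((A.add B).add (((dlogp x (by linarith)).pow 2).div_const 2)) ?_
    have : log (1 - x / (1 + x)) = -log (1 + x) := by
      rw [← log_inv]; congr 1; field_simp; ring
    simp only [this, sub_neg_eq_add]
    field_simp; push_cast; ring

lemma cont_log (s : ℝ) (h1 : s < 1) :
    ContinuousOn (fun t => log t * (log (1 + t) - log (1 - t))) (Icc 0 s) := by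
  rintro x ⟨hx, hx'⟩
  apply ContinuousAt.continuousWithinAt
  have c1 := (dlogp x (by linarith)).sub (dlogm x (by linarith))
  rcases hx.eq_or_lt with h | h
  · subst h
    have h2 := (hasDerivAt_iff_tendsto_slope.1 c1)
    have h3 := (Real.continuous_mul_log.tendsto 0).mono_left (nhdsWithin_le_nhds (s := {0}ᶜ))
    have h4 := h3.mul h2
    rw [continuousAt_iff_punctured_nhds]
    refine (h4.congr' ?_).trans (by simp)
    filter_upwards [self_mem_nhdsWithin] with t ht
    have : t ≠ 0 := ht
    simp [slope_def_field]
    field_simp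
  · exact (continuousAt_log h.ne').mul c1.continuousAt

lemma euler (s : ℝ) (h0 : 0 < s) (h1 : s < 1) :
    Li 2 ((1 - s) / (1 + s)) - Li 2 (-((1 - s) / (1 + s))) + Li 2 s - Li 2 (-s)
      = π ^ 2 / 4 + log s * (log (1 + s) - log (1 - s)) := by
  have m1 : Li 2 (-1) = -(π ^ 2 / 12) := by
    have := sq2 1 one_pos le_rfl
    norm_num [Li2_one] at this; linarith
  have := const_aux (fun t => Li 2 ((1 - t) / (1 + t)) - Li 2 (-((1 - t) / (1 + t)))
    + Li 2 t - Li 2 (-t) - log t * (log (1 + t) - log (1 - t))) s h0 ?_ ?_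
  · simp [Li_zero, m1, Li2_one] at this; linarith
  · refine ((((Li_comp_cont 2 le_rfl _ _ ?_ ?_).sub (Li_comp_cont 2 le_rfl _ _ ?_ ?_)).add
      (Li_comp_cont 2 le_rfl (fun t => t) _ (by fun_prop) ?_)).sub
      (Li_comp_cont 2 le_rfl _ _ (by fun_prop) ?_)).sub (cont_log s h1)
    · rintro x ⟨hx, hx'⟩
      exact (dU x (by linarith)).continuousAt.continuousWithinAt
    · rintro x ⟨hx, hx'⟩
      exact bU x hx (by linarith)
    · rintro x ⟨hx, hx'⟩
      exact (dU x (by linarith)).neg.continuousAt.continuousWithinAt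
    · rintro x ⟨hx, hx'⟩
      rw [abs_neg]
      exact bU x hx (by linarith)
    · rintro x ⟨hx, hx'⟩
      rw [abs_le]; constructor <;> linarith
    · rintro x ⟨hx, hx'⟩
      rw [abs_le]; constructor <;> linarith
  · rintro x ⟨hx, hx'⟩
    have hp : 0 < 1 + x := by linarith
    have hm : 0 < 1 - x := by linarith
    have A := Li2_comp _ _ x (dU x (by linarith)) (bU' x hx (by linarith)) (by positivity)
    have A2 := Li2_comp _ _ x (dU x (by linarith)).neg
      (by simp only [Pi.neg_apply]; rw [abs_neg]; exact bU' x hx (by linarith))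
      (by simp only [Pi.neg_apply]; exact neg_ne_zero.2 (by positivity))
    have B := Li2_comp (fun t => t) _ x (hasDerivAt_id x)
      (by rw [abs_lt]; constructor <;> linarith) hx.ne'
    have B2 := Li2_comp (fun t => -t) _ x (hasDerivAt_neg x)
      (by rw [abs_lt]; constructor <;> linarith) (by linarith)
    refine HasDerivAt.congr_deriv ((((A.sub A2).add B).sub B2).sub ((hasDerivAt_log hx.ne').mul
      ((dlogp x (by linarith)).sub (dlogm x (by linarith))))) ?_
    have e1 : log (1 - (1 - x) / (1 + x)) = log 2 + log x - log (1 + x) := by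
      rw [← log_mul (by norm_num) hx.ne', ← log_div (by positivity) hp.ne']
      congr 1; field_simp; ring
    have e2 : log (1 + (1 - x) / (1 + x)) = log 2 - log (1 + x) := by
      rw [← log_div (by positivity) hp.ne']
      congr 1; field_simp; ring
    simp only [Pi.neg_apply, Pi.sub_apply, e1, e2, sub_neg_eq_add]
    field_simp; ring

lemma dC (x : ℝ) (h0 : 0 ≤ x) (hx : x < 1) :
    HasDerivAt (fun t : ℝ => -(t ^ 2 / (1 - t ^ 2))) (-1 / (1 - x ^ 2) ^ 2 * (2 * x)) x := by
  have := (dA (x ^ 2) (by nlinarith)).comp x (hasDerivAt_pow 2 x)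
  refine HasDerivAt.congr_deriv (this) ?_
  push_cast; simp

lemma main_fe :
    Li 3 (-(1/3)) - Li 3 (1/3) - 2 * Li 3 (-1) - 2 * Li 3 (1/3) + 1/2 * Li 3 (-(1/3))
      - (π^2/4 * log 3 - (log 3)^3/4) = Li 3 (-1) - Li 3 1 := by
  have := const_aux (fun t => Li 3 (-((1 - t) / (1 + t))) - Li 3 ((1 - t) / (1 + t))
    - 2 * Li 3 (-(t / (1 - t))) - 2 * Li 3 (t / (1 + t)) + 1/2 * Li 3 (-(t^2 / (1 - t^2)))
    - (π^2/4 * (log (1 + t) - log (1 - t))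
      + 1/2 * (log t * (log (1 + t) - log (1 - t)) * (log (1 + t) - log (1 - t)))
      - (log (1 - t))^3/3 - (log (1 + t))^3/3 + (log (1 - t) + log (1 + t))^3/12))
      (1/2) (by norm_num) ?_ ?_
  · have l1 : log (1 + 1/2) = log 3 - log 2 := by
      rw [← log_div (by norm_num) (by norm_num)]; norm_num
    have l2 : log (1 - 1/2) = - log 2 := by
      rw [← log_inv]; norm_num
    have l3 : log (1/2) = - log 2 := by
      rw [← log_inv]; norm_num
    simp only [l1, l2, l3] at this
    norm_num [Li_zero] at this ⊢
    linear_combination this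
  · have cp : ContinuousOn (fun t => log (1 + t)) (Icc 0 (1/2)) := by
      rintro x ⟨hx, hx'⟩
      exact (dlogp x (by linarith)).continuousAt.continuousWithinAt
    have cm : ContinuousOn (fun t => log (1 - t)) (Icc 0 (1/2)) := by
      rintro x ⟨hx, hx'⟩
      exact (dlogm x (by linarith)).continuousAt.continuousWithinAt
    have cl := cont_log (1/2) (by norm_num)
    have cE := ((((continuousOn_const (c := π^2/4)).mul (cp.sub cm)).add
      ((continuousOn_const (c := 1/2)).mul (cl.mul (cp.sub cm)))).sub
      ((cm.pow 3).div_const 3)).sub ((cp.pow 3).div_const 3) |>.add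
      (((cm.add cp).pow 3).div_const 12)
    have h3 : 2 ≤ 3 := by norm_num
    refine (((((Li_comp_cont 3 h3 _ _ ?_ ?_).sub (Li_comp_cont 3 h3 _ _ ?_ ?_)).sub
      (continuousOn_const.mul (Li_comp_cont 3 h3 _ _ ?_ ?_))).sub
      (continuousOn_const.mul (Li_comp_cont 3 h3 _ _ ?_ ?_))).add
      (continuousOn_const.mul (Li_comp_cont 3 h3 _ _ ?_ ?_))).sub cE <;> rintro x ⟨hx, hx'⟩
    · exact (dU x (by linarith)).neg.continuousAt.continuousWithinAt
    · rw [abs_neg]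
      exact bU x hx (by linarith)
    · exact (dU x (by linarith)).continuousAt.continuousWithinAt
    · exact bU x hx (by linarith)
    · exact (dA x (by linarith)).continuousAt.continuousWithinAt
    · exact bA x hx (by linarith)
    · exact (dB x (by linarith)).continuousAt.continuousWithinAt
    · exact (bB x hx).le
    · exact (dC x hx (by linarith)).continuousAt.continuousWithinAt
    · exact bA (x^2) (by positivity) (by nlinarith)
  · rintro x ⟨hx, hx'⟩
    have hp : 0 < 1 + x := by linarith
    have hm : 0 < 1 - x := by linarith
    have hq : 0 < 1 - x^2 := by nlinarith
    have U := Li3_comp _ _ x (dU x (by linarith)) (bU' x hx (by linarith)) (by positivity)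
    have U2 := Li3_comp (fun t => -((1 - t) / (1 + t))) _ x (dU x (by linarith)).neg
      (by rw [abs_neg]; exact bU' x hx (by linarith))
      (neg_ne_zero.2 (by positivity))
    have A := Li3_comp _ _ x (dA x (by linarith)) (bA' x hx.le hx')
      (neg_ne_zero.2 (by positivity))
    have B := Li3_comp _ _ x (dB x (by linarith)) (bB x hx.le) (by positivity)
    have C := Li3_comp _ _ x (dC x hx.le (by linarith)) (bA' (x^2) (by positivity) (by nlinarith))
      (neg_ne_zero.2 (by positivity))
    have P := dlogp x (by linarith)
    have M := dlogm x (by linarith)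
    have L := hasDerivAt_log hx.ne'
    have E := ((((P.sub M).const_mul (π^2/4)).add
      (((L.mul (P.sub M)).mul (P.sub M)).const_mul (1/2))).sub
      ((M.pow 3).div_const 3)).sub ((P.pow 3).div_const 3) |>.add
      (((M.add P).pow 3).div_const 12)
    refine HasDerivAt.congr_deriv ((((((U2.sub U).sub (A.const_mul 2)).sub (B.const_mul 2)).add
      (C.const_mul (1/2))).sub E)) ?_
    have eu := euler x hx (by linarith)
    have lq : log (1 - x ^ 2) = log (1 - x) + log (1 + x) := by
      rw [← log_mul (by linarith) (by linarith)]; ring_nf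
    have eu' : Li 2 ((1 - x) / (1 + x)) = Li 2 (-((1 - x) / (1 + x))) - Li 2 x + Li 2 (-x)
      + (π ^ 2 / 4 + log x * (log (1 + x) - log (1 - x))) := by linarith
    simp only [Pi.mul_apply, Pi.sub_apply, Pi.add_apply, eu', landenA x hx hx'.le,
      landenB x hx (by linarith), landenA (x^2) (by positivity) (by nlinarith),
      sq2 x hx (by linarith), lq]
    have q : 1 - x^2 = (1 - x) * (1 + x) := by ring
    rw [q]
    generalize Li 2 (-((1 - x) / (1 + x))) = a1
    generalize Li 2 (-x) = a2
    generalize Li 2 x = a3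
    generalize log (1 - x) = a4
    generalize log (1 + x) = a5
    generalize log x = a6
    field_simp; push_cast; ring

/-- The trilogarithm identity
`2·Li₃(1/3) − Li₃(−1/3) = (13·ζ(3) − π²·log(3) + log³(3))/6`,
where `ζ(3) = ∑_{n≥1} 1/n³`. -/
theorem trilog_identity :
    2 * Li 3 (1 / 3) - Li 3 (-(1 / 3))
      = (13 * (∑' n : ℕ, 1 / ((n : ℝ) + 1) ^ 3) - Real.pi ^ 2 * Real.log 3
          + (Real.log 3) ^ 3) / 6 := by
  have h : (∑' n : ℕ, 1 / ((n : ℝ) + 1) ^ 3) = Li 3 1 := by simp [Li]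
  rw [h]
  linear_combination (-2/3) * main_fe + (1/2) * sq3
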